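/- No relaxation gap (Theorem 3): Fix T > 0, compact sets X ⊆ ℝⁿ, X₀ ⊆ X, X_u ⊆ X, a function f : ℝ × ℝⁿ → ℝⁿ Lipschitz in each argument on [0,T] × X, and a continuous cost c on X × X_u. Assume the non-return property: if a trajectory starting in X₀ touches ∂X at time t then it does not return to X on (t, T]. Then d* = P*, where d* is the supremum of γ over dual-feasible triples (γ, v, w) and P* is the infimum of c(x(t_p | x₀), y) over all t_p ∈ [0,T], x₀ ∈ X₀, y ∈ X_u along trajectories of ẋ = f(t,x) that remain in X on [0, t_p]. In particular, for every δ > 0 there exists a dual-feasible triple (γ, v, w) with P* − δ ≤ γ ≤ P*. -/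

import Mathlib

open MeasureTheory Set

noncomputable section

/-- `ℝⁿ` -/
abbrev Vec (n : ℕ) : Type := EuclideanSpace ℝ (Fin n)

/-- Lie derivative of `v` along the vector field `f`. -/
def LieD {n : ℕ} (f : ℝ × Vec n → Vec n) (v : ℝ × Vec n → ℝ) (p : ℝ × Vec n) : ℝ :=
  fderiv ℝ v p ((1 : ℝ), f p)

/-- A dual-feasible triple `(γ, v, w)` for the distance-estimation function program. -/
def DualFeasible {n : ℕ} (T : ℝ) (X X0 Xu : Set (Vec n)) (f : ℝ × Vec n → Vec n)
    (c : Vec n × Vec n → ℝ) (γ : ℝ) (v : ℝ × Vec n → ℝ) (w : Vec n → ℝ) : Prop :=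
  ContDiff ℝ 1 v ∧ Continuous w ∧
  (∀ x ∈ X0, γ ≤ v (0, x)) ∧
  (∀ x ∈ X, ∀ y ∈ Xu, w x ≤ c (x, y)) ∧
  (∀ t ∈ Icc 0 T, ∀ x ∈ X, v (t, x) ≤ w x) ∧
  (∀ t ∈ Icc 0 T, ∀ x ∈ X, 0 ≤ LieD f v (t, x))

/-- An admissible trajectory: `t_p ∈ [0,T]`, `x(0) ∈ X₀`, `x` solves `ẋ = f(t,x)` on
`[0, t_p]` and remains in `X` there. -/
def Admissible {n : ℕ} (T : ℝ) (X X0 : Set (Vec n)) (f : ℝ × Vec n → Vec n)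
    (x : ℝ → Vec n) (tp : ℝ) : Prop :=
  tp ∈ Icc 0 T ∧ x 0 ∈ X0 ∧ (∀ t ∈ Icc 0 tp, HasDerivAt x (f (t, x t)) t) ∧
  ∀ t ∈ Icc 0 tp, x t ∈ X

/-- The minimal distance `P*` of trajectories to the unsafe set. -/
def PStar {n : ℕ} (T : ℝ) (X X0 Xu : Set (Vec n)) (f : ℝ × Vec n → Vec n)
    (c : Vec n × Vec n → ℝ) : ℝ :=
  sInf {r | ∃ (x : ℝ → Vec n) (tp : ℝ) (y : Vec n),
    Admissible T X X0 f x tp ∧ y ∈ Xu ∧ r = c (x tp, y)}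

open scoped NNReal Topology

section Flow

variable {E : Type*} [NormedAddCommGroup E] [NormedSpace ℝ E]

theorem exists_solution_Ioo [CompleteSpace E] {G : E → E} {K M : ℝ≥0} (hG : LipschitzWith K G)
    (hM : ∀ x, ‖G x‖ ≤ M) (p : E) (A : ℝ≥0) :
    ∃ φ : ℝ → E, φ 0 = p ∧ ∀ t ∈ Ioo (-A : ℝ) A, HasDerivAt φ (G (φ t)) t := by
  have hA : (0 : ℝ) ∈ Icc (-A : ℝ) A := by simp
  have h : IsPicardLindelof (fun _ ↦ G) (tmin := -A) (tmax := A) ⟨0, hA⟩ p (M * A) 0 M K :=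
    { lipschitzOnWith := fun _ _ ↦ hG.lipschitzOnWith
      continuousOn := fun _ _ ↦ continuousOn_const
      norm_le := fun _ _ x _ ↦ hM x
      mul_max_le := by simp }
  obtain ⟨φ, h0, h1⟩ := h.exists_eq_forall_mem_Icc_hasDerivWithinAt₀
  exact ⟨φ, h0, fun t ht ↦ (h1 t (Ioo_subset_Icc_self ht)).hasDerivAt (Icc_mem_nhds ht.1 ht.2)⟩

/-- `Φ` is a global flow of the autonomous vector field `G`. -/
def IsGlobalFlow (G : E → E) (Φ : ℝ → E → E) : Prop :=
  ∀ p, Φ 0 p = p ∧ ∀ t, HasDerivAt (fun s ↦ Φ s p) (G (Φ t p)) t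

theorem exists_isGlobalFlow [CompleteSpace E] {G : E → E} {K M : ℝ≥0} (hG : LipschitzWith K G)
    (hM : ∀ x, ‖G x‖ ≤ M) : ∃ Φ, IsGlobalFlow G Φ := by
  choose φ h0 h1 using exists_solution_Ioo hG hM
  have key : ∀ (p : E) (A B : ℝ≥0) (t : ℝ), |t| < A → |t| < B → φ p A t = φ p B t := by
    intro p A B t hA hB
    have hAB : |t| < (min A B : ℝ≥0) := by simp [hA, hB]
    have hpos : (0 : ℝ) < (min A B : ℝ≥0) := (abs_nonneg t).trans_lt hAB
    refine ODE_solution_unique_of_mem_Ioo (v := fun _ ↦ G) (s := fun _ ↦ univ) (K := K)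
      (a := -(min A B : ℝ≥0)) (b := (min A B : ℝ≥0)) (t₀ := 0)
      (fun _ _ ↦ hG.lipschitzOnWith) ⟨by linarith, hpos⟩ (fun s hs ↦ ⟨h1 p A s ?_, trivial⟩)
      (fun s hs ↦ ⟨h1 p B s ?_, trivial⟩) ((h0 p A).trans (h0 p B).symm) (abs_lt.1 hAB)
    · exact abs_lt.1 ((abs_lt.2 hs).trans_le (by simp))
    · exact abs_lt.1 ((abs_lt.2 hs).trans_le (by simp))
  refine ⟨fun t p ↦ φ p (Real.nnabs t + 1) t, fun p ↦ ⟨h0 p _, fun t ↦ ?_⟩⟩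
  have h2 : |t| < (Real.nnabs t + 1 + 1 : ℝ≥0) := by simp; linarith
  have h3 := h1 p (Real.nnabs t + 1 + 1) t (abs_lt.1 h2)
  have h4 : φ p (Real.nnabs t + 1) t = φ p (Real.nnabs t + 1 + 1) t :=
    key _ _ _ _ (by simp) h2
  beta_reduce
  rw [h4]
  refine h3.congr_of_eventuallyEq ?_
  have : ∀ᶠ s in 𝓝 t, |s| < |t| + 1 + 1 :=
    (continuous_abs.tendsto t).eventually (gt_mem_nhds (by linarith))
  filter_upwards [this] with s hs
  exact key _ _ _ _ (by simp) (by simpa using hs)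

namespace IsGlobalFlow

variable {G : E → E} {Φ : ℝ → E → E} {K M : ℝ≥0}

theorem continuous (h : IsGlobalFlow G Φ) (p : E) : Continuous fun s ↦ Φ s p :=
  continuous_iff_continuousAt.2 fun t ↦ ((h p).2 t).continuousAt

theorem map_add (h : IsGlobalFlow G Φ) (hG : LipschitzWith K G) (s t : ℝ) (p : E) :
    Φ (s + t) p = Φ s (Φ t p) := by
  refine congrFun (ODE_solution_unique_univ (v := fun _ ↦ G) (s := fun _ ↦ univ) (K := K)
    (f := fun s ↦ Φ (s + t) p) (g := fun s ↦ Φ s (Φ t p)) (t₀ := 0)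
    (fun _ ↦ hG.lipschitzOnWith) (fun s ↦ ⟨?_, trivial⟩) (fun s ↦ ⟨(h _).2 s, trivial⟩) ?_) s
  · exact ((h p).2 (s + t)).comp_add_const s t
  · simp [(h _).1]

theorem dist_le (h : IsGlobalFlow G Φ) (hG : LipschitzWith K G) {s : ℝ} (hs : 0 ≤ s) (p q : E) :
    dist (Φ s p) (Φ s q) ≤ dist p q * Real.exp (K * s) := by
  have := dist_le_of_trajectories_ODE (v := fun _ ↦ G) (K := K) (a := 0) (b := s)
    (f := fun s ↦ Φ s p) (g := fun s ↦ Φ s q) (δ := dist p q) (fun _ ↦ hG)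
    (h.continuous p).continuousOn (fun t _ ↦ ((h p).2 t).hasDerivWithinAt)
    (h.continuous q).continuousOn (fun t _ ↦ ((h q).2 t).hasDerivWithinAt)
    (by simp [(h _).1]) s ⟨hs, le_rfl⟩
  simpa using this

theorem dist_time_le (h : IsGlobalFlow G Φ) (hM : ∀ x, ‖G x‖ ≤ M) (p : E) (s t : ℝ) :
    dist (Φ s p) (Φ t p) ≤ M * dist s t :=
  (lipschitzWith_of_nnnorm_deriv_le (f := fun s ↦ Φ s p) (C := M)
    (fun t ↦ ((h p).2 t).differentiableAt)
    (fun t ↦ by rw [((h p).2 t).deriv]; exact hM _)).dist_le_mul s t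

theorem norm_sub_euler_le (h : IsGlobalFlow G Φ) (hG : LipschitzWith K G) (hM : ∀ x, ‖G x‖ ≤ M)
    (p : E) {s : ℝ} (hs : 0 ≤ s) : ‖Φ s p - (p + s • G p)‖ ≤ K * M * s ^ 2 := by
  have hd : ∀ r ∈ Icc 0 s, HasDerivWithinAt (fun r ↦ Φ r p - (p + r • G p))
      (G (Φ r p) - G p) (Icc 0 s) r := by
    intro r _
    have h1 : HasDerivAt (fun r : ℝ ↦ p + r • G p) (G p) r := by
      simpa using ((hasDerivAt_id r).smul_const (G p)).const_add p
    exact (((h p).2 r).sub h1).hasDerivWithinAt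
  have := norm_image_sub_le_of_norm_deriv_le_segment' hd (C := K * M * s) (fun r hr ↦ ?_) s
    ⟨hs, le_rfl⟩
  · simpa [(h p).1, pow_two, mul_assoc] using this
  · rw [← dist_eq_norm]
    calc dist (G (Φ r p)) (G p) ≤ K * dist (Φ r p) (Φ 0 p) := by
          simpa [(h p).1] using hG.dist_le_mul (Φ r p) (Φ 0 p)
      _ ≤ K * (M * s) := by
          gcongr
          refine (h.dist_time_le hM p r 0).trans ?_
          rw [Real.dist_eq, sub_zero, abs_of_nonneg hr.1]
          gcongr
          exact hr.2.le
      _ = K * M * s := by ring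

end IsGlobalFlow

end Flow

section Mollify

variable {E : Type*} [NormedAddCommGroup E] [NormedSpace ℝ E] [FiniteDimensional ℝ E]

/-- Mollification of a Lipschitz function that almost does not decrease along a vector field. -/
theorem exists_contDiff_approx_of_le_along {V : E → ℝ} {G : E → E} {L K : ℝ≥0}
    (hV : LipschitzWith L V) (hG : LipschitzWith K G) {Y : Set E} {ε α β : ℝ} (hε : 0 < ε)
    (h : ∀ p ∈ Y, ∀ q, dist q p ≤ ε → ∀ t ∈ Ioc (0 : ℝ) 1,
      V q - t * α - t ^ 2 * β ≤ V (q + t • G q)) :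
    ∃ v : E → ℝ, ContDiff ℝ 1 v ∧ (∀ x, |v x - V x| ≤ L * ε) ∧
      ∀ p ∈ Y, -(α + L * K * ε) ≤ fderiv ℝ v p (G p) := by
  borelize E
  let μ : Measure E := .addHaar
  set φ : ContDiffBump (0 : E) := ⟨ε / 2, ε, half_pos hε, half_lt_self hε⟩
  set v : E → ℝ := convolution (φ.normed μ) V (ContinuousLinearMap.lsmul ℝ ℝ) μ with hv
  have hvd : ContDiff ℝ 1 v := φ.hasCompactSupport_normed.contDiff_convolution_left _
    φ.contDiff_normed (hV.continuous.locallyIntegrable)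
  have hint : ∀ x, Integrable (fun q ↦ φ.normed μ q * V (x - q)) μ := fun x ↦
    (φ.continuous_normed.mul (hV.continuous.comp (by fun_prop))).integrable_of_hasCompactSupport
      φ.hasCompactSupport_normed.mul_right
  have hvx : ∀ x, v x = ∫ q, φ.normed μ q * V (x - q) ∂μ := fun x ↦ by
    simp [hv, convolution]
  refine ⟨v, hvd, fun x ↦ ?_, fun p hp ↦ ?_⟩
  · refine φ.dist_normed_convolution_le hV.continuous.aestronglyMeasurable fun y hy ↦ ?_
    refine (hV.dist_le_mul y x).trans ?_
    gcongr
    exact (Metric.mem_ball.1 hy).le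
  · have hquot : ∀ t ∈ Ioc (0 : ℝ) 1,
        -(α + L * K * ε) - t * β ≤ t⁻¹ • (v (p + t • G p) - v p) := by
      intro t ht
      rw [smul_eq_mul, le_inv_mul_iff₀ ht.1, hvx, hvx, ← integral_sub (hint _) (hint _)]
      have hconst : t * (-(α + L * K * ε) - t * β)
          = ∫ q, φ.normed μ q * (t * (-(α + L * K * ε) - t * β)) ∂μ := by
        rw [integral_mul_const, φ.integral_normed, one_mul]
      rw [hconst]
      refine integral_mono (φ.integrable_normed.mul_const _) ((hint _).sub (hint _)) fun q ↦ ?_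
      rw [← mul_sub]
      by_cases hq : q ∈ Metric.ball (0 : E) ε
      · refine mul_le_mul_of_nonneg_left ?_ (φ.nonneg_normed q)
        have hqn : ‖q‖ ≤ ε := by simpa using (Metric.mem_ball.1 hq).le
        have h1 := h p hp (p - q) (by simpa [dist_eq_norm] using hqn) t ht
        have h2 : |V (p + t • G p - q) - V (p - q + t • G (p - q))| ≤ L * (t * (K * ε)) := by
          refine (hV.dist_le_mul _ _).trans ?_
          gcongr
          have : p + t • G p - q - (p - q + t • G (p - q)) = t • (G p - G (p - q)) := by
            rw [smul_sub]; abel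
          rw [dist_eq_norm, this, norm_smul, Real.norm_of_nonneg ht.1.le, ← dist_eq_norm]
          gcongr
          · exact ht.1.le
          refine (hG.dist_le_mul _ _).trans ?_
          gcongr
          simpa [dist_eq_norm] using hqn
        have h3 := (abs_le.1 h2).1
        nlinarith
      · have : φ.normed μ q = 0 := by
          rw [← Function.notMem_support, φ.support_normed_eq]
          exact hq
        simp [this]
    have hlim : Filter.Tendsto (fun t : ℝ ↦ t⁻¹ • (v (p + t • G p) - v p)) (𝓝[>] 0)
        (𝓝 (fderiv ℝ v p (G p))) :=
      ((hvd.differentiable one_ne_zero p).hasFDerivAt.hasLineDerivAt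
        (G p)).tendsto_slope_zero_right
    have hlim' : Filter.Tendsto (fun t : ℝ ↦ -(α + L * K * ε) - t * β) (𝓝[>] 0)
        (𝓝 (-(α + L * K * ε))) := by
      have : Continuous fun t : ℝ ↦ -(α + L * K * ε) - t * β := by fun_prop
      simpa using (this.tendsto 0).mono_left nhdsWithin_le_nhds
    refine le_of_tendsto_of_tendsto hlim' hlim ?_
    filter_upwards [Ioc_mem_nhdsGT (zero_lt_one' ℝ)] with t ht using hquot t ht

end Mollify

section Value

variable {E : Type*} [NormedAddCommGroup E] [NormedSpace ℝ E]

/-- Cost of following the flow for time `s`: terminal cost plus running cost. -/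
noncomputable def flowCost (Φ : ℝ → E → E) (C g : E → ℝ) (p : E) (s : ℝ) : ℝ :=
  C (Φ s p) + ∫ r in (0 : ℝ)..s, g (Φ r p)

variable {G : E → E} {Φ : ℝ → E → E} {C g : E → ℝ} {K M LC Lg : ℝ≥0}

theorem IsGlobalFlow.abs_integral_sub_le (h : IsGlobalFlow G Φ) (hG : LipschitzWith K G)
    (hg : LipschitzWith Lg g) {s S : ℝ} (hs : s ∈ Icc 0 S) (p q : E) :
    |(∫ r in (0 : ℝ)..s, g (Φ r p)) - ∫ r in (0 : ℝ)..s, g (Φ r q)|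
      ≤ Lg * Real.exp (K * S) * S * dist p q := by
  have hc : ∀ p, IntervalIntegrable (fun r ↦ g (Φ r p)) volume 0 s := fun p ↦
    (hg.continuous.comp (h.continuous p)).intervalIntegrable _ _
  rw [← intervalIntegral.integral_sub (hc p) (hc q)]
  have := intervalIntegral.norm_integral_le_of_norm_le_const (a := 0) (b := s)
    (f := fun r ↦ g (Φ r p) - g (Φ r q)) (C := Lg * (dist p q * Real.exp (K * S))) ?_
  · refine this.trans ?_
    rw [sub_zero, abs_of_nonneg hs.1]
    calc Lg * (dist p q * Real.exp (K * S)) * s ≤ Lg * (dist p q * Real.exp (K * S)) * S := by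
          gcongr
          exact hs.2
      _ = _ := by ring
  · intro r hr
    rw [uIoc_of_le hs.1] at hr
    refine (hg.dist_le_mul _ _).trans ?_
    gcongr
    refine (h.dist_le hG hr.1.le p q).trans ?_
    gcongr
    exact hr.2.trans hs.2

theorem IsGlobalFlow.abs_flowCost_sub_le (h : IsGlobalFlow G Φ) (hG : LipschitzWith K G)
    (hC : LipschitzWith LC C) (hg : LipschitzWith Lg g) {s S : ℝ} (hs : s ∈ Icc 0 S) (p q : E) :
    |flowCost Φ C g p s - flowCost Φ C g q s|
      ≤ (LC * Real.exp (K * S) + Lg * Real.exp (K * S) * S) * dist p q := by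
  have h1 : |C (Φ s p) - C (Φ s q)| ≤ LC * (dist p q * Real.exp (K * S)) := by
    refine (hC.dist_le_mul _ _).trans ?_
    gcongr
    refine (h.dist_le hG hs.1 p q).trans ?_
    gcongr
    exact hs.2
  have h2 := h.abs_integral_sub_le hG hg hs p q
  unfold flowCost
  rw [add_sub_add_comm]
  refine (abs_add_le _ _).trans ?_
  linarith

theorem IsGlobalFlow.continuous_flowCost (h : IsGlobalFlow G Φ) (hC : Continuous C)
    (hg : Continuous g) (p : E) : Continuous (flowCost Φ C g p) :=
  (hC.comp (h.continuous p)).add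
    (intervalIntegral.continuous_primitive
      (fun _ _ ↦ (hg.comp (h.continuous p)).intervalIntegrable _ _) 0)

theorem IsGlobalFlow.flowCost_add (h : IsGlobalFlow G Φ) (hG : LipschitzWith K G)
    (hg : Continuous g) (p : E) (s t : ℝ) :
    flowCost Φ C g p (s + t) = flowCost Φ C g (Φ t p) s + ∫ r in (0 : ℝ)..t, g (Φ r p) := by
  have hc : ∀ a b, IntervalIntegrable (fun r ↦ g (Φ r p)) volume a b := fun a b ↦
    (hg.comp (h.continuous p)).intervalIntegrable _ _
  have h1 : ∫ r in (0 : ℝ)..s, g (Φ r (Φ t p)) = ∫ r in t..(s + t), g (Φ r p) := by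
    simp_rw [← h.map_add hG]
    rw [intervalIntegral.integral_comp_add_right (fun r ↦ g (Φ r p)), zero_add]
  unfold flowCost
  rw [h1, h.map_add hG, add_assoc, add_comm (∫ r in t..(s + t), g (Φ r p)),
    intervalIntegral.integral_add_adjacent_intervals (hc _ _) (hc _ _)]

theorem IsGlobalFlow.integral_le (h : IsGlobalFlow G Φ) (hM : ∀ x, ‖G x‖ ≤ M)
    (hg : LipschitzWith Lg g) (p : E) {t : ℝ} (ht : 0 ≤ t) :
    ∫ r in (0 : ℝ)..t, g (Φ r p) ≤ t * g p + Lg * M * t ^ 2 := by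
  have := intervalIntegral.integral_mono_on (a := 0) (b := t) (f := fun r ↦ g (Φ r p))
    (g := fun _ ↦ g p + Lg * (M * t)) (μ := volume) ht
    ((hg.continuous.comp (h.continuous p)).intervalIntegrable _ _) (by simp) fun r hr ↦ ?_
  · rw [intervalIntegral.integral_const, sub_zero, smul_eq_mul] at this
    linarith
  · have h1 : |g (Φ r p) - g p| ≤ Lg * (M * t) := by
      refine (hg.dist_le_mul _ _).trans ?_
      gcongr
      have := h.dist_time_le hM p r 0
      rw [(h p).1, Real.dist_eq, sub_zero, abs_of_nonneg hr.1] at this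
      refine this.trans ?_
      gcongr
      exact hr.2
    linarith [(abs_le.1 h1).2]

/-- A Lipschitz value function for the optimal stopping of the flow. -/
theorem IsGlobalFlow.exists_valueFunction (h : IsGlobalFlow G Φ) (hG : LipschitzWith K G)
    (hM : ∀ x, ‖G x‖ ≤ M) (hC : LipschitzWith LC C) (hg : LipschitzWith Lg g)
    {S : ℝ} (hS : 0 ≤ S) {U : Set E}
    (hU : ∀ p ∈ U, ∀ s ∈ Icc S (S + 1), C p ≤ flowCost Φ C g p s) :
    ∃ (V : E → ℝ) (LV : ℝ≥0) (β : ℝ), LipschitzWith LV V ∧ (∀ p, V p ≤ C p) ∧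
      (∀ p a, (∀ s ∈ Icc 0 S, a ≤ flowCost Φ C g p s) → a ≤ V p) ∧
      ∀ p ∈ U, ∀ t ∈ Ioc (0 : ℝ) 1, V p - t * g p - t ^ 2 * β ≤ V (p + t • G p) := by
  let V : E → ℝ := fun p ↦ sInf (flowCost Φ C g p '' Icc 0 S)
  have hne : (Icc 0 S).Nonempty := nonempty_Icc.2 hS
  have hbdd : ∀ p, BddBelow (flowCost Φ C g p '' Icc 0 S) := fun p ↦
    (isCompact_Icc.image (h.continuous_flowCost hC.continuous hg.continuous p)).bddBelow
  have hVle : ∀ p, ∀ s ∈ Icc 0 S, V p ≤ flowCost Φ C g p s := fun p s hs ↦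
    csInf_le (hbdd p) (mem_image_of_mem _ hs)
  have hleV : ∀ p a, (∀ s ∈ Icc 0 S, a ≤ flowCost Φ C g p s) → a ≤ V p := fun p a ha ↦
    le_csInf (hne.image _) (forall_mem_image.2 ha)
  have hVC : ∀ p, V p ≤ C p := fun p ↦ by
    simpa [flowCost, (h p).1] using hVle p 0 ⟨le_rfl, hS⟩
  let LV : ℝ≥0 := ⟨LC * Real.exp (K * S) + Lg * Real.exp (K * S) * S, by positivity⟩
  have hLV : LipschitzWith LV V := LipschitzWith.of_le_add_mul LV fun p q ↦ by
    rw [← sub_le_iff_le_add]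
    refine hleV _ _ fun s hs ↦ ?_
    have h1 := (abs_le.1 (h.abs_flowCost_sub_le hG hC hg hs p q)).2
    have h2 := hVle p s hs
    change V p - (LC * Real.exp (K * S) + Lg * Real.exp (K * S) * S) * dist p q ≤ _
    linarith
  refine ⟨V, LV, Lg * M + LV * (K * M), hLV, hVC, hleV, fun p hp t ht ↦ ?_⟩
  have hstep : V p - ∫ r in (0 : ℝ)..t, g (Φ r p) ≤ V (Φ t p) := by
    refine hleV _ _ fun s hs ↦ ?_
    rw [sub_le_iff_le_add, ← h.flowCost_add hG hg.continuous]
    rcases le_total (s + t) S with hst | hst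
    · exact hVle p _ ⟨add_nonneg hs.1 ht.1.le, hst⟩
    · exact (hVC p).trans (hU p hp _ ⟨hst, add_le_add hs.2 ht.2⟩)
  have h1 := h.integral_le hM hg p ht.1.le
  have h2 : |V (Φ t p) - V (p + t • G p)| ≤ LV * (K * M * t ^ 2) := by
    refine (hLV.dist_le_mul _ _).trans ?_
    rw [dist_eq_norm]
    gcongr
    exact h.norm_sub_euler_le hG hM p ht.1.le
  have h3 := (abs_le.1 h2).2
  linarith

/-- A `C¹` approximate subsolution of the optimal stopping problem of the flow. -/
theorem IsGlobalFlow.exists_contDiff_subsolution [FiniteDimensional ℝ E] (h : IsGlobalFlow G Φ)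
    (hG : LipschitzWith K G) (hM : ∀ x, ‖G x‖ ≤ M) (hC : LipschitzWith LC C)
    (hg : LipschitzWith Lg g) {Y : Set E} (hgY : ∀ p ∈ Y, g p = 0) {S : ℝ} (hS : 0 ≤ S)
    (hU : ∀ q, (∃ p ∈ Y, dist q p ≤ 1) → ∀ s ∈ Icc S (S + 1), C q ≤ flowCost Φ C g q s)
    {η : ℝ} (hη : 0 < η) :
    ∃ v : E → ℝ, ContDiff ℝ 1 v ∧ (∀ p, v p ≤ C p + η) ∧
      (∀ p a, (∀ s ∈ Icc 0 S, a ≤ flowCost Φ C g p s) → a - η ≤ v p) ∧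
      ∀ p ∈ Y, -η ≤ fderiv ℝ v p (G p) := by
  obtain ⟨V, L, β, hL, hVC, hleV, hstep⟩ :=
    h.exists_valueFunction hG hM hC hg hS (U := {q | ∃ p ∈ Y, dist q p ≤ 1}) hU
  set D : ℝ := 1 + Lg + L + L * K with hD
  have hDpos : 1 ≤ D := by
    have : (0 : ℝ) ≤ Lg + L + L * K := by positivity
    rw [hD]
    linarith
  set ε : ℝ := min 1 (η / D)
  have hεpos : 0 < ε := by positivity
  have hεD : D * ε ≤ η := by
    calc D * ε ≤ D * (η / D) := by gcongr; exact min_le_right _ _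
      _ = η := by field_simp
  have hLg : (0 : ℝ) ≤ Lg * ε := by positivity
  have hL0 : (0 : ℝ) ≤ L * ε := by positivity
  have hLK : (0 : ℝ) ≤ L * K * ε := by positivity
  obtain ⟨v, hv, hvV, hvG⟩ := exists_contDiff_approx_of_le_along hL hG (Y := Y) (ε := ε)
    (α := Lg * ε) (β := β) hεpos fun p hp q hqp t ht ↦ by
      have h1 := hstep q ⟨p, hp, hqp.trans (min_le_left _ _)⟩ t ht
      have h2 : g q ≤ Lg * ε := by
        have h3 : |g q - g p| ≤ Lg * ε := (hg.dist_le_mul q p).trans (by gcongr)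
        rw [hgY p hp, sub_zero] at h3
        exact (le_abs_self _).trans h3
      have h4 : t * g q ≤ t * (Lg * ε) := mul_le_mul_of_nonneg_left h2 ht.1.le
      linarith
  refine ⟨v, hv, fun p ↦ ?_, fun p a ha ↦ ?_, fun p hp ↦ ?_⟩
  · have := (abs_le.1 (hvV p)).2
    have := hVC p
    nlinarith
  · have := (abs_le.1 (hvV p)).1
    have := hleV p a ha
    nlinarith
  · have := hvG p hp
    nlinarith

end Value

section Approximation

/-- A cost that is continuous on a compact product has a Lipschitz minorant in the first variable
which almost equals the minimum over the second variable. -/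
theorem exists_lipschitz_minorant {α β : Type*} [MetricSpace α] [MetricSpace β] {A : Set α}
    {B : Set β} (hA : IsCompact A) (hB : IsCompact B) (hAB : (A ×ˢ B).Nonempty) {c : α × β → ℝ}
    (hc : ContinuousOn c (A ×ˢ B)) {η : ℝ} (hη : 0 < η) :
    ∃ (C : α → ℝ) (L : ℝ≥0), LipschitzWith L C ∧ (∀ x ∈ A, ∀ y ∈ B, C x ≤ c (x, y)) ∧
      ∀ x ∈ A, ∃ y ∈ B, c (x, y) ≤ C x + 2 * η := by
  have hAB' := hA.prod hB
  have huc := hAB'.uniformContinuousOn_of_continuous hc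
  obtain ⟨ρ, hρ, hcρ⟩ := Metric.uniformContinuousOn_iff.1 huc η hη
  obtain ⟨N, hN⟩ := hAB'.exists_bound_of_continuousOn hc
  have hN0 : 0 ≤ N := (norm_nonneg _).trans (hN _ hAB.some_mem)
  let L : ℝ≥0 := ⟨2 * N / ρ, by positivity⟩
  let C : α → ℝ := fun x ↦ sInf ((fun q : α × β ↦ c q + L * dist x q.1) '' (A ×ˢ B))
  have hbdd : ∀ x, BddBelow ((fun q : α × β ↦ c q + L * dist x q.1) '' (A ×ˢ B)) := by
    refine fun x ↦ ⟨-N, forall_mem_image.2 fun q hq ↦ ?_⟩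
    have h1 := (abs_le.1 (hN q hq)).1
    have h2 : 0 ≤ L * dist x q.1 := by positivity
    linarith
  have hCle : ∀ x, ∀ q ∈ A ×ˢ B, C x ≤ c q + L * dist x q.1 := fun x q hq ↦
    csInf_le (hbdd x) (mem_image_of_mem _ hq)
  refine ⟨C, L, LipschitzWith.of_le_add_mul L fun x y ↦ ?_, fun x hx y hy ↦ ?_, fun x hx ↦ ?_⟩
  · rw [← sub_le_iff_le_add]
    refine le_csInf (hAB.image _) (forall_mem_image.2 fun q hq ↦ ?_)
    have h1 := hCle x q hq
    have h2 : L * dist x q.1 ≤ L * (dist x y + dist y q.1) := by gcongr; exact dist_triangle _ _ _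
    linarith
  · simpa using hCle x (x, y) ⟨hx, hy⟩
  · obtain ⟨_, ⟨q, hq, rfl⟩, hlt⟩ :=
      exists_lt_of_csInf_lt (hAB.image _) (lt_add_of_pos_right (C x) hη)
    refine ⟨q.2, hq.2, ?_⟩
    dsimp only at hlt
    have h2 : 0 ≤ L * dist x q.1 := by positivity
    rcases lt_or_ge (dist x q.1) ρ with hd | hd
    · have h1 := hcρ (x, q.2) ⟨hx, hq.2⟩ q hq (by simpa [Prod.dist_eq, hρ] using hd)
      have h3 := (abs_lt.1 h1).2
      linarith
    · have h1 : 2 * N ≤ L * dist x q.1 := by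
        calc 2 * N = 2 * N / ρ * ρ := by field_simp
          _ ≤ L * dist x q.1 := mul_le_mul_of_nonneg_left hd L.2
      have h3 := (abs_le.1 (hN _ (mk_mem_prod hx hq.2))).2
      have h4 := (abs_le.1 (hN q hq)).1
      linarith

theorem LipschitzOnWith.exists_bounded_extension {α : Type*} [PseudoMetricSpace α] {n : ℕ}
    {f : α → EuclideanSpace ℝ (Fin n)} {s : Set α} {K : ℝ≥0} (hf : LipschitzOnWith K f s)
    (hs : IsCompact s) :
    ∃ (F : α → EuclideanSpace ℝ (Fin n)) (K' M : ℝ≥0),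
      LipschitzWith K' F ∧ (∀ x, ‖F x‖ ≤ M) ∧ EqOn F f s := by
  obtain ⟨N, hN⟩ := hs.exists_bound_of_continuousOn hf.continuousOn
  let B : ℝ≥0 := N.toNNReal
  have hB : ∀ x ∈ s, ‖f x‖ ≤ B := fun x hx ↦ (hN x hx).trans (Real.le_coe_toNNReal N)
  obtain ⟨g, hg, hgf⟩ := ((PiLp.lipschitzWith_ofLp 2 (fun _ : Fin n ↦ ℝ)).comp_lipschitzOnWith
    hf).extend_pi
  have hle : -(B : ℝ) ≤ B := by linarith [B.2]
  have hclamp : LipschitzWith 1 (fun (y : Fin n → ℝ) i ↦ (projIcc (-(B : ℝ)) B hle (y i) : ℝ)) :=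
    LipschitzWith.of_dist_le_mul fun x y ↦ by
      refine (dist_pi_le_iff (by positivity)).2 fun i ↦ ?_
      refine ((LipschitzWith.projIcc hle).dist_le_mul _ _).trans ?_
      gcongr
      exact dist_le_pi_dist x y i
  obtain ⟨L, hL⟩ : ∃ L, LipschitzWith L (WithLp.toLp 2 : (Fin n → ℝ) → EuclideanSpace ℝ (Fin n)) :=
    ⟨_, PiLp.lipschitzWith_toLp 2 (fun _ : Fin n ↦ ℝ)⟩
  refine ⟨fun x ↦ WithLp.toLp 2 fun i ↦ (projIcc (-(B : ℝ)) B hle (g x i) : ℝ), _, L * B,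
    hL.comp (hclamp.comp hg), fun x ↦ ?_, fun x hx ↦ ?_⟩
  · have h1 := hL.dist_le_mul (fun i ↦ (projIcc (-(B : ℝ)) B hle (g x i) : ℝ)) 0
    rw [WithLp.toLp_zero, dist_zero_right, dist_zero_right] at h1
    refine h1.trans ?_
    push_cast
    gcongr
    refine (pi_norm_le_iff_of_nonneg B.2).2 fun i ↦ ?_
    have h2 := (projIcc (-(B : ℝ)) B hle (g x i)).2
    exact abs_le.2 h2
  · ext i
    have h1 : g x i = f x i := (congrFun (hgf hx) i).symm
    have h2 : |f x i| ≤ B := (PiLp.norm_apply_le (f x) i).trans (hB x hx)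
    change (projIcc (-(B : ℝ)) B hle (g x i) : ℝ) = f x i
    rw [h1, projIcc_of_mem hle (abs_le.1 h2)]

/-- Exact penalization on a compact set. -/
theorem IsCompact.exists_penalty {α : Type*} [TopologicalSpace α] {Q : Set α} (hQ : IsCompact Q)
    {A D : α → ℝ} (hA : ContinuousOn A Q) (hD : ContinuousOn D Q) (hD0 : ∀ q ∈ Q, 0 ≤ D q)
    {a : ℝ} (h : ∀ q ∈ Q, D q = 0 → a < A q) :
    ∃ k₀ : ℝ, 0 ≤ k₀ ∧ ∀ k, k₀ ≤ k → ∀ q ∈ Q, a ≤ A q + k * D q := by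
  rcases Q.eq_empty_or_nonempty with rfl | hne
  · exact ⟨0, le_rfl, by simp⟩
  have hnn : ∀ q ∈ Q, ∀ k : ℝ, 0 ≤ k → 0 ≤ k * D q := fun q hq k hk ↦ mul_nonneg hk (hD0 q hq)
  have hZ : ∃ Z, IsCompact Z ∧ Z = {q ∈ Q | A q ≤ a} := by
    obtain ⟨u, hu, hu'⟩ := continuousOn_iff_isClosed.1 hA (Iic a) isClosed_Iic
    refine ⟨_, hQ.inter_left hu, hu'.symm.trans ?_⟩
    ext q
    simp [and_comm]
  obtain ⟨Z, hZc, rfl⟩ := hZ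
  rcases {q ∈ Q | A q ≤ a}.eq_empty_or_nonempty with he | hZne
  · refine ⟨0, le_rfl, fun k hk q hq ↦ ?_⟩
    have h1 : a < A q := by
      by_contra! hle
      exact (he ▸ (⟨hq, hle⟩ : q ∈ {q ∈ Q | A q ≤ a}) : q ∈ (∅ : Set α))
    linarith [hnn q hq k hk]
  · obtain ⟨q₀, hq₀, hmin⟩ := hZc.exists_isMinOn hZne (hD.mono (sep_subset _ _))
    obtain ⟨q₁, hq₁, hmin'⟩ := hQ.exists_isMinOn hne hA
    have hm : 0 < D q₀ := (hD0 q₀ hq₀.1).lt_of_ne fun he ↦ (h q₀ hq₀.1 he.symm).not_ge hq₀.2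
    have hk₀ : 0 ≤ (a - A q₁) / D q₀ :=
      div_nonneg (sub_nonneg.2 ((hmin' hq₀.1).trans hq₀.2)) hm.le
    refine ⟨(a - A q₁) / D q₀, hk₀, fun k hk q hq ↦ ?_⟩
    rcases le_or_gt (A q) a with hle | hlt
    · have h1 : D q₀ ≤ D q := hmin (show q ∈ {q ∈ Q | A q ≤ a} from ⟨hq, hle⟩)
      have h2 : A q₁ ≤ A q := hmin' hq
      have h3 : a - A q₁ ≤ k * D q := by
        calc a - A q₁ = (a - A q₁) / D q₀ * D q₀ := by field_simp
          _ ≤ k * D q := mul_le_mul hk h1 hm.le (hk₀.trans hk)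
      linarith
    · linarith [hnn q hq k (hk₀.trans hk)]

end Approximation

section FlowCost

theorem flowCost_const_mul {E : Type*} {Φ : ℝ → E → E} {C g : E → ℝ}
    (k : ℝ) (p : E) (s : ℝ) :
    flowCost Φ C (fun q ↦ k * g q) p s
      = flowCost Φ C (fun _ ↦ 0) p s + k * flowCost Φ (fun _ ↦ 0) g p s := by
  simp [flowCost]

variable {E : Type*} [NormedAddCommGroup E] [NormedSpace ℝ E] {G : E → E} {Φ : ℝ → E → E}
  {C g : E → ℝ} {K M LC Lg : ℝ≥0}

theorem IsGlobalFlow.continuousOn_flowCost (h : IsGlobalFlow G Φ) (hG : LipschitzWith K G)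
    (hC : LipschitzWith LC C) (hg : LipschitzWith Lg g) {S : ℝ} (hS : 0 ≤ S) :
    ContinuousOn (fun q : E × ℝ ↦ flowCost Φ C g q.1 q.2) (univ ×ˢ Icc 0 S) :=
  continuousOn_prod_of_continuousOn_lipschitzOnWith _
    ⟨LC * Real.exp (K * S) + Lg * Real.exp (K * S) * S, by positivity⟩
    (fun p _ ↦ (h.continuous_flowCost hC.continuous hg.continuous p).continuousOn)
    fun _ hs ↦ LipschitzOnWith.of_dist_le_mul fun p _ q _ ↦
      h.abs_flowCost_sub_le hG hC hg hs p q

theorem IsGlobalFlow.mem_of_integral_infDist_eq_zero (h : IsGlobalFlow G Φ) {Y : Set E}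
    (hY : IsClosed Y) {p : E} (hp : p ∈ Y) {s : ℝ}
    (h0 : ∫ r in (0 : ℝ)..s, Metric.infDist (Φ r p) Y = 0) : ∀ r ∈ Icc 0 s, Φ r p ∈ Y := by
  intro r hr
  rcases (hr.1.trans hr.2).eq_or_lt with rfl | hs
  · obtain rfl : r = 0 := le_antisymm hr.2 hr.1
    rwa [(h p).1]
  by_contra hn
  have hc : Continuous fun r ↦ Metric.infDist (Φ r p) Y :=
    (Metric.continuous_infDist_pt Y).comp (h.continuous p)
  exact (intervalIntegral.integral_pos hs hc.continuousOn (fun _ _ ↦ Metric.infDist_nonneg)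
    ⟨r, hr, (hY.notMem_iff_infDist_pos ⟨p, hp⟩).1 hn⟩).ne' h0

end FlowCost

section Distance

variable {n : ℕ} {T : ℝ} {X X0 Xu : Set (Vec n)} {f : ℝ × Vec n → Vec n}
  {c : Vec n × Vec n → ℝ}

theorem DualFeasible.le_cost {γ : ℝ} {v : ℝ × Vec n → ℝ} {w : Vec n → ℝ}
    (h : DualFeasible T X X0 Xu f c γ v w) {x : ℝ → Vec n} {tp : ℝ} {y : Vec n}
    (hx : Admissible T X X0 f x tp) (hy : y ∈ Xu) : γ ≤ c (x tp, y) := by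
  obtain ⟨hv, -, hγ, hwc, hvw, hL⟩ := h
  obtain ⟨htp, hx0, hder, hxX⟩ := hx
  have hd : ∀ t ∈ Icc 0 tp, HasDerivAt (fun t ↦ v (t, x t)) (LieD f v (t, x t)) t := fun t ht ↦
    ((hv.differentiable one_ne_zero (t, x t)).hasFDerivAt).comp_hasDerivAt t
      ((hasDerivAt_id t).prodMk (hder t ht))
  have hmono : MonotoneOn (fun t ↦ v (t, x t)) (Icc 0 tp) := by
    refine monotoneOn_of_deriv_nonneg (convex_Icc 0 tp)
      (fun t ht ↦ (hd t ht).continuousAt.continuousWithinAt)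
      (fun t ht ↦ (hd t (interior_subset ht)).differentiableAt.differentiableWithinAt)
      fun t ht ↦ ?_
    have ht' := interior_subset ht
    rw [(hd t ht').deriv]
    exact hL t ⟨ht'.1, ht'.2.trans htp.2⟩ _ (hxX t ht')
  have htp' : tp ∈ Icc 0 tp := ⟨htp.1, le_rfl⟩
  calc γ ≤ v (0, x 0) := hγ _ hx0
    _ ≤ v (tp, x tp) := hmono ⟨le_rfl, htp.1⟩ htp' htp.1
    _ ≤ w (x tp) := hvw tp htp _ (hxX tp htp')
    _ ≤ c (x tp, y) := hwc _ (hxX tp htp') _ hy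

theorem IsGlobalFlow.fst_eq {F : ℝ × Vec n → Vec n} {Φ : ℝ → ℝ × Vec n → ℝ × Vec n}
    (h : IsGlobalFlow (fun p ↦ ((1 : ℝ), F p)) Φ) (p : ℝ × Vec n) (r : ℝ) :
    (Φ r p).1 = p.1 + r := by
  have hd : ∀ t, HasDerivAt (fun t ↦ (Φ t p).1 - t) 0 t := fun t ↦ by
    have h1 : HasDerivAt (fun t ↦ (Φ t p).1) 1 t :=
      (ContinuousLinearMap.fst ℝ ℝ (Vec n)).hasFDerivAt.comp_hasDerivAt t ((h p).2 t)
    simpa using h1.fun_sub (hasDerivAt_id' t)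
  have := is_const_of_deriv_eq_zero (fun t ↦ (hd t).differentiableAt) (fun t ↦ (hd t).deriv) r 0
  simp only [(h p).1, sub_zero] at this
  linarith

theorem bddBelow_cost (hX : IsCompact X) (hXu : IsCompact Xu) (hc : ContinuousOn c (X ×ˢ Xu)) :
    BddBelow {r | ∃ (x : ℝ → Vec n) (tp : ℝ) (y : Vec n),
      Admissible T X X0 f x tp ∧ y ∈ Xu ∧ r = c (x tp, y)} := by
  refine ((hX.prod hXu).image_of_continuousOn hc).bddBelow.mono ?_
  rintro _ ⟨x, tp, y, hx, hy, rfl⟩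
  exact mem_image_of_mem c ⟨hx.2.2.2 tp ⟨hx.1.1, le_rfl⟩, hy⟩

/-- Away from the time interval, the penalty dominates the variation of the terminal cost. -/
theorem IsGlobalFlow.one_le_integral_infDist {F : ℝ × Vec n → Vec n}
    {Φ : ℝ → ℝ × Vec n → ℝ × Vec n} (h : IsGlobalFlow (fun p ↦ ((1 : ℝ), F p)) Φ) (hT : 0 ≤ T)
    (hXne : X.Nonempty) {q : ℝ × Vec n} (hq : -1 ≤ q.1) {s : ℝ} (hs : 2 * T + 4 ≤ s) :
    1 ≤ ∫ r in (0 : ℝ)..s, Metric.infDist (Φ r q) (Icc 0 T ×ˢ X) := by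
  have hc : Continuous fun r ↦ Metric.infDist (Φ r q) (Icc 0 T ×ˢ X) :=
    (Metric.continuous_infDist_pt _).comp (h.continuous q)
  have hpt : ∀ r, r - (1 + T) ≤ Metric.infDist (Φ r q) (Icc 0 T ×ˢ X) := fun r ↦ by
    refine (Metric.le_infDist ((nonempty_Icc.2 hT).prod hXne)).2 fun y hy ↦ ?_
    have h1 : (Φ r q).1 - y.1 ≤ dist (Φ r q) y :=
      (le_abs_self _).trans (le_max_left (dist (Φ r q).1 y.1) _)
    rw [h.fst_eq] at h1
    linarith [hy.1.2]
  have hint := intervalIntegral.integral_mono_on (μ := volume) (a := 0) (b := s) (by linarith)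
    ((continuous_id'.sub continuous_const).intervalIntegrable _ _)
    (hc.intervalIntegrable _ _) (fun r _ ↦ hpt r)
  refine le_trans ?_ hint
  have : ∫ r in (0 : ℝ)..s, (r - (1 + T)) = s ^ 2 / 2 - (1 + T) * s := by
    rw [intervalIntegral.integral_sub (continuous_id'.intervalIntegrable _ _) (by simp)]
    simp
    ring
  calc 1 ≤ s ^ 2 / 2 - (1 + T) * s := by nlinarith
    _ = _ := this.symm

theorem admissible_zero (hT : 0 ≤ T) (hX0X : X0 ⊆ X) {x₀ : Vec n} (hx₀ : x₀ ∈ X0) :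
    Admissible T X X0 f (fun t ↦ x₀ + t • f (0, x₀)) 0 := by
  refine ⟨⟨le_rfl, hT⟩, by simpa using hx₀, fun t ht ↦ ?_, fun t ht ↦ ?_⟩
  all_goals
    obtain rfl : t = 0 := le_antisymm ht.2 ht.1
  · simpa using ((hasDerivAt_id' (0 : ℝ)).smul_const (f (0, x₀))).const_add x₀
  · simpa using hX0X hx₀

theorem exists_dualFeasible_of_empty (hX : IsCompact X) (hXu : IsCompact Xu)
    (hc : ContinuousOn c (X ×ˢ Xu)) (hempty : X0 = ∅ ∨ Xu = ∅) (γ : ℝ) :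
    ∃ v w, DualFeasible T X X0 Xu f c γ v w := by
  have key : ∀ m : ℝ, (∀ x ∈ X0, γ ≤ m) → (∀ x ∈ X, ∀ y ∈ Xu, m ≤ c (x, y)) →
      ∃ v w, DualFeasible T X X0 Xu f c γ v w := fun m h1 h2 ↦
    ⟨fun _ ↦ m, fun _ ↦ m, contDiff_const, continuous_const, h1, h2, fun _ _ _ _ ↦ le_rfl,
      fun _ _ _ _ ↦ by simp [LieD]⟩
  rcases hempty with rfl | rfl
  · obtain ⟨m, hm⟩ := ((hX.prod hXu).image_of_continuousOn hc).bddBelow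
    exact key m (by simp) fun x hx y hy ↦ hm (mem_image_of_mem c ⟨hx, hy⟩)
  · exact key γ (fun _ _ ↦ le_rfl) (by simp)

theorem exists_dualFeasible (hT : 0 < T) (hX : IsCompact X) (hX0 : IsCompact X0)
    (hXu : IsCompact Xu) (hX0X : X0 ⊆ X) (hX0ne : X0.Nonempty) (hXune : Xu.Nonempty)
    {K : ℝ≥0} (hf : LipschitzOnWith K f (Icc 0 T ×ˢ X)) (hc : ContinuousOn c (X ×ˢ Xu))
    {δ : ℝ} (hδ : 0 < δ) :
    ∃ v w, DualFeasible T X X0 Xu f c (PStar T X X0 Xu f c - δ) v w := by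
  have hXne : X.Nonempty := hX0ne.mono hX0X
  set Y : Set (ℝ × Vec n) := Icc 0 T ×ˢ X
  have hY : IsCompact Y := isCompact_Icc.prod hX
  set η : ℝ := δ / 8 with hη
  have hηpos : 0 < η := by positivity
  set P := PStar T X X0 Xu f c
  obtain ⟨F, KF, MF, hF, hFM, hFf⟩ := hf.exists_bounded_extension hY
  obtain ⟨C, LC, hC, hCc, hcC⟩ := exists_lipschitz_minorant hX hXu (hXne.prod hXune) hc hηpos
  set G : ℝ × Vec n → ℝ × Vec n := fun p ↦ (1, F p) with hG
  have hGL : LipschitzWith (max 0 KF) G := (LipschitzWith.const 1).prodMk hF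
  have hGM : ∀ p, ‖G p‖ ≤ (max 1 MF : ℝ≥0) := fun p ↦ by
    simp only [hG, Prod.norm_mk, norm_one, NNReal.coe_max, NNReal.coe_one]
    exact max_le_max le_rfl (hFM p)
  obtain ⟨Φ, hΦ⟩ := exists_isGlobalFlow hGL hGM
  set M : ℝ≥0 := max 1 MF
  have hC' : LipschitzWith (LC * 1) fun p : ℝ × Vec n ↦ C p.2 := hC.comp LipschitzWith.prod_snd
  have hdist : LipschitzWith 1 fun p ↦ Metric.infDist p Y := Metric.lipschitz_infDist_pt Y
  set S : ℝ := 2 * T + 4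
  have hS0 : 0 ≤ S := by positivity
  have hzero : LipschitzWith 0 (fun _ : ℝ × Vec n ↦ (0 : ℝ)) := LipschitzWith.const 0
  have hQsub : (({0} : Set ℝ) ×ˢ X0) ×ˢ Icc 0 S ⊆ univ ×ˢ Icc 0 S :=
    prod_mono (subset_univ _) le_rfl
  obtain ⟨k₀, -, hk₀⟩ := ((isCompact_singleton.prod hX0).prod isCompact_Icc).exists_penalty
    (a := P - 3 * η) ((hΦ.continuousOn_flowCost hGL hC' hzero hS0).mono hQsub)
    ((hΦ.continuousOn_flowCost hGL hzero hdist hS0).mono hQsub)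
    (fun q hq ↦ by
      simp only [flowCost, zero_add]
      exact intervalIntegral.integral_nonneg hq.2.1 fun _ _ ↦ Metric.infDist_nonneg)
    (by
      rintro ⟨⟨t, x⟩, s⟩ ⟨⟨ht, hx⟩, hs⟩ hD
      obtain rfl : t = 0 := ht
      simp only [flowCost, zero_add, intervalIntegral.integral_zero, add_zero] at hD ⊢
      have hmem := hΦ.mem_of_integral_infDist_eq_zero hY.isClosed
        (p := (0, x)) ⟨⟨le_rfl, hT.le⟩, hX0X hx⟩ hD
      have hfst : ∀ r, (Φ r (0, x)).1 = r := fun r ↦ by simpa using hΦ.fst_eq (0, x) r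
      have hsT : s ∈ Icc 0 T := by
        have := (hmem s ⟨hs.1, le_rfl⟩).1
        rwa [hfst] at this
      obtain ⟨y, hy, hcy⟩ := hcC _ (hmem s ⟨hs.1, le_rfl⟩).2
      have hadm : Admissible T X X0 f (fun r ↦ (Φ r (0, x)).2) s := by
        refine ⟨hsT, by simpa [(hΦ _).1] using hx, fun r hr ↦ ?_, fun r hr ↦ (hmem r hr).2⟩
        have h1 : HasDerivAt (fun r ↦ (Φ r (0, x)).2) (F (Φ r (0, x))) r :=
          (ContinuousLinearMap.snd ℝ ℝ (Vec n)).hasFDerivAt.comp_hasDerivAt r ((hΦ (0, x)).2 r)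
        have h2 : Φ r (0, x) = (r, (Φ r (0, x)).2) := Prod.ext (hfst r) rfl
        rwa [hFf (hmem r hr), h2] at h1
      have hPle : P ≤ c ((Φ s (0, x)).2, y) :=
        csInf_le (bddBelow_cost hX hXu hc) ⟨_, s, y, hadm, hy, rfl⟩
      linarith)
  let S' : ℝ≥0 := ⟨S + 1, by positivity⟩
  let k : ℝ≥0 := max k₀.toNNReal (LC * 1 * (M * S'))
  have hk1 : k₀ ≤ k := (Real.le_coe_toNNReal k₀).trans (NNReal.coe_le_coe.2 (le_max_left _ _))
  have hk2 : (LC * 1 : ℝ≥0) * (M * (S + 1)) ≤ k := by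
    have h1 : ((LC * 1 * (M * S') : ℝ≥0) : ℝ) ≤ k := NNReal.coe_le_coe.2 (le_max_right _ _)
    rwa [NNReal.coe_mul, NNReal.coe_mul M] at h1
  have hg : LipschitzWith (k * 1) fun p ↦ (k : ℝ) * Metric.infDist p Y :=
    LipschitzWith.of_dist_le_mul fun p q ↦ by
      rw [Real.dist_eq, ← mul_sub, abs_mul, NNReal.abs_eq, NNReal.coe_mul, mul_assoc]
      gcongr
      exact hdist.dist_le_mul p q
  obtain ⟨v, hv, hvC, hlev, hvG⟩ := hΦ.exists_contDiff_subsolution hGL hGM hC' hg (Y := Y)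
    (fun p hp ↦ by rw [Metric.infDist_zero_of_mem hp, mul_zero]) hS0 (by
      rintro q ⟨p, hp, hqp⟩ s hs
      have hq1 : -1 ≤ q.1 := by
        have h1 : |q.1 - p.1| ≤ 1 := (le_max_left (dist q.1 p.1) _).trans hqp
        linarith [(abs_le.1 h1).1, hp.1.1]
      have h1 := hΦ.one_le_integral_infDist hT.le hXne hq1 hs.1
      have h2 : |C (Φ s q).2 - C q.2| ≤ (LC * 1 : ℝ≥0) * (M * (S + 1)) := by
        refine (hC'.dist_le_mul (Φ s q) q).trans ?_
        gcongr
        have h3 := hΦ.dist_time_le hGM q s 0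
        rw [(hΦ q).1, Real.dist_eq, sub_zero, abs_of_nonneg (hS0.trans hs.1)] at h3
        refine h3.trans ?_
        gcongr
        exact hs.2
      have h4 := (abs_le.1 h2).1
      have h5 : (k : ℝ) * 1 ≤ k * ∫ r in (0 : ℝ)..s, Metric.infDist (Φ r q) Y := by gcongr
      rw [flowCost_const_mul]
      simp only [flowCost, intervalIntegral.integral_zero, add_zero, zero_add]
      linarith) (η := min η (η / T)) (by positivity)
  have hη1 : min η (η / T) ≤ η := min_le_left _ _
  have hη2 : min η (η / T) ≤ η / T := min_le_right _ _
  refine ⟨fun p ↦ v p + (η / T * (p.1 - T) - η), C, by fun_prop, hC.continuous, fun x hx ↦ ?_,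
    hCc, fun t ht x hx ↦ ?_, fun t ht x hx ↦ ?_⟩
  · have h1 := hlev (0, x) (P - 3 * η) fun s hs ↦ by
      rw [flowCost_const_mul]
      exact hk₀ k hk1 ((0, x), s) ⟨⟨rfl, hx⟩, hs⟩
    have h2 : η / T * (0 - T) = -η := by field_simp; ring
    dsimp only
    rw [h2]
    linarith
  · have h1 := hvC (t, x)
    have h2 : η / T * (t - T) ≤ 0 :=
      mul_nonpos_of_nonneg_of_nonpos (by positivity) (by linarith [ht.2])
    dsimp only at h1 ⊢
    linarith
  · have h1 := hvG (t, x) ⟨ht, hx⟩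
    have h2 : HasFDerivAt (fun p : ℝ × Vec n ↦ v p + (η / T * (p.1 - T) - η))
        (fderiv ℝ v (t, x) + (η / T) • ContinuousLinearMap.fst ℝ ℝ (Vec n)) (t, x) :=
      (hv.differentiable one_ne_zero (t, x)).hasFDerivAt.add
        (((hasFDerivAt_fst.sub_const T).const_mul (η / T)).sub_const η)
    have h3 : G (t, x) = (1, f (t, x)) := Prod.ext rfl (hFf ⟨ht, hx⟩)
    rw [h3] at h1
    rw [LieD, h2.fderiv]
    simp only [add_apply, smul_apply, ContinuousLinearMap.coe_fst', smul_eq_mul, mul_one]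
    linarith

end Distance

/-- **Theorem 3**: no relaxation gap, `d* = P*`.  Under compactness,
Lipschitz dynamics, continuity of the cost, and the non-return assumption A4, the
function-program value equals the minimal trajectory distance, and for every `δ > 0`
there is a dual-feasible triple with `P* − δ ≤ γ ≤ P*`. -/
theorem no_relaxation_gap {n : ℕ} (T : ℝ) (hT : 0 < T)
    (X X0 Xu : Set (Vec n)) (hX : IsCompact X) (hX0 : IsCompact X0) (hXu : IsCompact Xu)
    (hX0X : X0 ⊆ X) (hXuX : Xu ⊆ X)
    (f : ℝ × Vec n → Vec n) (K : NNReal) (hf : LipschitzOnWith K f (Icc 0 T ×ˢ X))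
    (c : Vec n × Vec n → ℝ) (hc : ContinuousOn c (X ×ˢ Xu))
    (hA4 : ∀ x : ℝ → Vec n, x 0 ∈ X0 →
      (∀ t ∈ Icc (0 : ℝ) T, HasDerivAt x (f (t, x t)) t) →
      ∀ t ∈ Icc (0 : ℝ) T, x t ∈ frontier X → ∀ t' ∈ Ioc t T, x t' ∉ X) :
    sSup {γ | ∃ v w, DualFeasible T X X0 Xu f c γ v w} = PStar T X X0 Xu f c ∧
    ∀ δ : ℝ, 0 < δ → ∃ (γ : ℝ) (v : ℝ × Vec n → ℝ) (w : Vec n → ℝ),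
      DualFeasible T X X0 Xu f c γ v w ∧
      PStar T X X0 Xu f c - δ ≤ γ ∧ γ ≤ PStar T X X0 Xu f c := by
  rcases em (X0.Nonempty ∧ Xu.Nonempty) with ⟨hX0ne, hXune⟩ | hempty
  · have hle : ∀ γ ∈ {γ | ∃ v w, DualFeasible T X X0 Xu f c γ v w}, γ ≤ PStar T X X0 Xu f c := by
      rintro γ ⟨v, w, h⟩
      obtain ⟨x₀, hx₀⟩ := hX0ne
      obtain ⟨y₀, hy₀⟩ := hXune
      refine le_csInf ⟨_, _, 0, y₀, admissible_zero hT.le hX0X hx₀, hy₀, rfl⟩ ?_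
      rintro _ ⟨x, tp, y, hx, hy, rfl⟩
      exact h.le_cost hx hy
    have hex : ∀ δ : ℝ, 0 < δ → ∃ v w, DualFeasible T X X0 Xu f c (PStar T X X0 Xu f c - δ) v w :=
      fun δ hδ ↦ exists_dualFeasible hT hX hX0 hXu hX0X hX0ne hXune hf hc hδ
    refine ⟨le_antisymm (csSup_le ⟨_, hex 1 one_pos⟩ hle) ?_, fun δ hδ ↦ ?_⟩
    · exact le_of_forall_sub_le fun δ hδ ↦ le_csSup ⟨_, hle⟩ (hex δ hδ)
    · obtain ⟨v, w, h⟩ := hex δ hδ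
      exact ⟨_, v, w, h, le_rfl, by linarith⟩
  · have hemp : X0 = ∅ ∨ Xu = ∅ := by
      simpa only [not_and_or, not_nonempty_iff_eq_empty] using hempty
    have hex := exists_dualFeasible_of_empty (T := T) (f := f) hX hXu hc hemp
    have hP : PStar T X X0 Xu f c = 0 := by
      have : {r | ∃ (x : ℝ → Vec n) (tp : ℝ) (y : Vec n),
          Admissible T X X0 f x tp ∧ y ∈ Xu ∧ r = c (x tp, y)} = ∅ := by
        rw [eq_empty_iff_forall_notMem]
        rintro _ ⟨x, tp, y, hx, hy, rfl⟩
        exact hempty ⟨⟨_, hx.2.1⟩, ⟨y, hy⟩⟩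
      rw [PStar, this, Real.sInf_empty]
    rw [hP]
    refine ⟨?_, fun δ hδ ↦ ?_⟩
    · rw [show {γ | ∃ v w, DualFeasible T X X0 Xu f c γ v w} = univ from
        eq_univ_of_forall hex, Real.sSup_univ]
    · obtain ⟨v, w, h⟩ := hex 0
      exact ⟨0, v, w, h, by linarith, le_rfl⟩
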